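/- For α ∈ (0,1) let a(α) be the parameter vector with a(α)_s = α^{γ_s}. Then, as α → 0+, sup_{x ∈ X} | L^{(a(α))}(x)/(−log α) − Σ_{s∈𝓢} Σ_{k∈K^s} γ_s x_k | → 0; that is, the normalized functions L^{(a(α))}/(−log α) converge uniformly on X to the weighted-number-of-servers objective Σ_s Σ_{k∈K^s} γ_s x_k. -/

import Mathlib

open scoped BigOperators
open Filter Topology

noncomputable section

variable {I S : Type} [Fintype I] [DecidableEq I] [Fintype S]

/-- The configuration `e_i` consisting of a single type-`i` customer. -/
def econf (i : I) : I → ℕ := Pi.single i 1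

/-- `K^s`: the set of nonzero configurations of server type `s`. -/
def Kc (Kbar : S → Finset (I → ℕ)) (s : S) : Finset (I → ℕ) := (Kbar s).erase 0

/-- Monotonicity of the configuration sets. -/
def KbarMono (Kbar : S → Finset (I → ℕ)) : Prop :=
  ∀ s, ∀ k ∈ Kbar s, ∀ k' : I → ℕ, (∀ i, k' i ≤ k i) → k' ∈ Kbar s

/-- Each configuration set contains the zero configuration. -/
def KbarZero (Kbar : S → Finset (I → ℕ)) : Prop := ∀ s, (0 : I → ℕ) ∈ Kbar s

/-- Every customer type can be served by some server type. -/
def KbarServe (Kbar : S → Finset (I → ℕ)) : Prop := ∀ i : I, ∃ s, econf i ∈ Kbar s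

/-- `ℝ_+^K`: nonnegative vectors supported on the nonzero configurations. -/
def orthK (Kbar : S → Finset (I → ℕ)) : Set (S → (I → ℕ) → ℝ) :=
  {x | (∀ s k, 0 ≤ x s k) ∧ ∀ s, ∀ k, k ∉ Kc Kbar s → x s k = 0}

/-- The feasible set `X` (equality constraints). -/
def feasX (Kbar : S → Finset (I → ℕ)) (ρ : I → ℝ) : Set (S → (I → ℕ) → ℝ) :=
  {x | x ∈ orthK Kbar ∧ ∀ i, ∑ s, ∑ k ∈ Kc Kbar s, (k i : ℝ) * x s k = ρ i}

/-- The relaxed feasible set (inequality constraints). -/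
def feasXge (Kbar : S → Finset (I → ℕ)) (ρ : I → ℝ) : Set (S → (I → ℕ) → ℝ) :=
  {x | x ∈ orthK Kbar ∧ ∀ i, ρ i ≤ ∑ s, ∑ k ∈ Kc Kbar s, (k i : ℝ) * x s k}

/-- The weighted number of occupied servers. -/
def objW (Kbar : S → Finset (I → ℕ)) (γ : S → ℝ) (x : S → (I → ℕ) → ℝ) : ℝ :=
  ∑ s, ∑ k ∈ Kc Kbar s, γ s * x s k

/-- `X*`: optimal solutions of LP=. -/
def XstarSet (Kbar : S → Finset (I → ℕ)) (ρ : I → ℝ) (γ : S → ℝ) :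
    Set (S → (I → ℕ) → ℝ) :=
  {x | x ∈ feasX Kbar ρ ∧ ∀ y ∈ feasX Kbar ρ, objW Kbar γ x ≤ objW Kbar γ y}

/-- `X**`: optimal solutions of LP≤. -/
def XstarSetGe (Kbar : S → Finset (I → ℕ)) (ρ : I → ℝ) (γ : S → ℝ) :
    Set (S → (I → ℕ) → ℝ) :=
  {x | x ∈ feasXge Kbar ρ ∧ ∀ y ∈ feasXge Kbar ρ, objW Kbar γ x ≤ objW Kbar γ y}

/-- `H*`: dual optimal vectors. -/
def HstarSet (Kbar : S → Finset (I → ℕ)) (ρ : I → ℝ) (γ : S → ℝ) : Set (I → ℝ) :=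
  {η | ∃ x ∈ feasX Kbar ρ, (∀ i, 0 ≤ η i) ∧
    (∀ s, ∀ k ∈ Kc Kbar s, ∑ i, (k i : ℝ) * η i ≤ γ s) ∧
    (∀ s, ∀ k ∈ Kc Kbar s, (∑ i, (k i : ℝ) * η i) < γ s → x s k = 0)}

/-- `c_k = ∏_i k_i!`. -/
def ck (k : I → ℕ) : ℝ := ∏ i, (Nat.factorial (k i) : ℝ)

/-- The function `L^{(a)}`. -/
def Lfun (Kbar : S → Finset (I → ℕ)) (a : S → ℝ) (x : S → (I → ℕ) → ℝ) : ℝ :=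
  ∑ s, ∑ k ∈ Kc Kbar s, x s k * Real.log (x s k * ck k / (Real.exp 1 * a s))

/-- Product form (infinite-server system). -/
def prodForm (Kbar : S → Finset (I → ℕ)) (a : S → ℝ) (x : S → (I → ℕ) → ℝ)
    (ν : I → ℝ) : Prop :=
  ∀ s, ∀ k ∈ Kc Kbar s, x s k = a s / ck k * Real.exp (∑ i, (k i : ℝ) * ν i)

/-- ℓ¹ distance on the coordinates indexed by `K`. -/
def distK (Kbar : S → Finset (I → ℕ)) (x y : S → (I → ℕ) → ℝ) : ℝ :=
  ∑ s, ∑ k ∈ Kc Kbar s, |x s k - y s k|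

/-- Extended coordinate value: the zero configuration of type `s` has value `a_s`. -/
def xval (a : S → ℝ) (x : S → (I → ℕ) → ℝ) (s : S) (k : I → ℕ) : ℝ :=
  if k = 0 then a s else x s k

/-- `x_{(i)}`: amount of servers available to a type-`i` arrival (GRAND(aZ)). -/
def xavail (Kbar : S → Finset (I → ℕ)) (a : S → ℝ) (x : S → (I → ℕ) → ℝ) (i : I) : ℝ :=
  ∑ s, ((if econf i ∈ Kc Kbar s then a s else 0)
    + ∑ k ∈ (Kc Kbar s).filter (fun k => k + econf i ∈ Kbar s), x s k)

/-- Departure rate `w_{k i}`. -/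
def wrate (μ : I → ℝ) (x : S → (I → ℕ) → ℝ) (s : S) (k : I → ℕ) (i : I) : ℝ :=
  (k i : ℝ) * μ i * x s k

/-- Arrival rate `v_{k i}` (GRAND(aZ)), with `λ_i = μ_i ρ_i`. -/
def vrate (Kbar : S → Finset (I → ℕ)) (a : S → ℝ) (μ ρ : I → ℝ)
    (x : S → (I → ℕ) → ℝ) (s : S) (k : I → ℕ) (i : I) : ℝ :=
  μ i * ρ i * xval a x s (k - econf i) / xavail Kbar a x i

/-- The GRAND(aZ) fluid vector field `F_k(x)`, for `k ∈ K^s`. -/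
def Fdrift (Kbar : S → Finset (I → ℕ)) (a : S → ℝ) (μ ρ : I → ℝ)
    (x : S → (I → ℕ) → ℝ) (s : S) (k : I → ℕ) : ℝ :=
  (∑ i ∈ Finset.univ.filter (fun i : I => 1 ≤ k i ∧ k - econf i ∈ Kbar s),
    (vrate Kbar a μ ρ x s k i - wrate μ x s k i))
  - ∑ i ∈ Finset.univ.filter (fun i : I => k + econf i ∈ Kbar s),
    (vrate Kbar a μ ρ x s (k + econf i) i - wrate μ x s (k + econf i) i)

/-- The function `Ξ(x)` (GRAND(aZ)). -/
def Xi (Kbar : S → Finset (I → ℕ)) (a : S → ℝ) (μ : I → ℝ)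
    (x : S → (I → ℕ) → ℝ) : ℝ :=
  ∑ i : I, ∑ s : S,
    ∑ k ∈ (Kc Kbar s).filter (fun k => 1 ≤ k i ∧ k - econf i ∈ Kbar s),
      ∑ s' : S,
        ∑ k' ∈ (Kc Kbar s').filter (fun k' => 1 ≤ k' i ∧ k' - econf i ∈ Kbar s'),
          (Real.log ((k' i : ℝ) * xval a x s (k - econf i) * x s' k')
            - Real.log ((k i : ℝ) * x s k * xval a x s' (k' - econf i)))
          * ((k i : ℝ) * μ i * x s k * xval a x s' (k' - econf i) / xavail Kbar a x i)

open Classical in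
/-- `Ξ` extended by `−∞` to points with a vanishing coordinate, as a map into `[−∞, 0] ⊆ EReal`. -/
def XiE (Kbar : S → Finset (I → ℕ)) (a : S → ℝ) (μ : I → ℝ)
    (x : S → (I → ℕ) → ℝ) : EReal :=
  if ∀ s, ∀ k ∈ Kc Kbar s, 0 < x s k then ((Xi Kbar a μ x : ℝ) : EReal) else ⊥

/-! Finite-server (GRAND-F) objects. -/

/-- `X^□`. -/
def XBox (Kbar : S → Finset (I → ℕ)) (h : S → ℝ) : Set (S → (I → ℕ) → ℝ) :=
  {x | x ∈ orthK Kbar ∧ ∀ s, ∑ k ∈ Kc Kbar s, x s k ≤ h s}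

/-- `x_{0^s} = h_s − Σ_{k∈K^s} x_k`. -/
def x0 (Kbar : S → Finset (I → ℕ)) (h : S → ℝ) (x : S → (I → ℕ) → ℝ) (s : S) : ℝ :=
  h s - ∑ k ∈ Kc Kbar s, x s k

/-- `X^⋄ = X^□ ∩ X`. -/
def XDiamond (Kbar : S → Finset (I → ℕ)) (h : S → ℝ) (ρ : I → ℝ) :
    Set (S → (I → ℕ) → ℝ) := XBox Kbar h ∩ feasX Kbar ρ

/-- Assumption A: a feasible point with idle servers of every type. -/
def AssumptionA (Kbar : S → Finset (I → ℕ)) (h : S → ℝ) (ρ : I → ℝ) : Prop :=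
  ∃ x ∈ XDiamond Kbar h ρ, ∀ s, 0 < x0 Kbar h x s

/-- The function `L^□`. -/
def LBox (Kbar : S → Finset (I → ℕ)) (h : S → ℝ) (x : S → (I → ℕ) → ℝ) : ℝ :=
  ∑ s, (x0 Kbar h x s * Real.log (x0 Kbar h x s / Real.exp 1)
    + ∑ k ∈ Kc Kbar s, x s k * Real.log (x s k * ck k / Real.exp 1))

/-- Product form (finite-server system), including the zero configurations. -/
def prodFormBox (Kbar : S → Finset (I → ℕ)) (h : S → ℝ) (x : S → (I → ℕ) → ℝ)
    (ν : I → ℝ) (β : S → ℝ) : Prop :=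
  ∀ s, x0 Kbar h x s = Real.exp (-β s) ∧
    ∀ k ∈ Kc Kbar s, x s k = Real.exp (-β s) / ck k * Real.exp (∑ i, (k i : ℝ) * ν i)

/-- Extended coordinate value for the finite-server system. -/
def xvalBox (Kbar : S → Finset (I → ℕ)) (h : S → ℝ) (x : S → (I → ℕ) → ℝ)
    (s : S) (k : I → ℕ) : ℝ :=
  if k = 0 then x0 Kbar h x s else x s k

/-- `x_{(i)}` for the finite-server system (zero configurations included). -/
def xavailBox (Kbar : S → Finset (I → ℕ)) (h : S → ℝ) (x : S → (I → ℕ) → ℝ)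
    (i : I) : ℝ :=
  ∑ s, ((if econf i ∈ Kc Kbar s then x0 Kbar h x s else 0)
    + ∑ k ∈ (Kc Kbar s).filter (fun k => k + econf i ∈ Kbar s), x s k)

/-- Arrival rate `v_{k i}` (GRAND-F), with `λ_i = μ_i ρ_i`. -/
def vrateBox (Kbar : S → Finset (I → ℕ)) (h : S → ℝ) (μ ρ : I → ℝ)
    (x : S → (I → ℕ) → ℝ) (s : S) (k : I → ℕ) (i : I) : ℝ :=
  μ i * ρ i * xvalBox Kbar h x s (k - econf i) / xavailBox Kbar h x i

/-- The GRAND-F fluid vector field `F^□_k(x)`, for `k ∈ K^s`. -/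
def FdriftBox (Kbar : S → Finset (I → ℕ)) (h : S → ℝ) (μ ρ : I → ℝ)
    (x : S → (I → ℕ) → ℝ) (s : S) (k : I → ℕ) : ℝ :=
  (∑ i ∈ Finset.univ.filter (fun i : I => 1 ≤ k i ∧ k - econf i ∈ Kbar s),
    (vrateBox Kbar h μ ρ x s k i - wrate μ x s k i))
  - ∑ i ∈ Finset.univ.filter (fun i : I => k + econf i ∈ Kbar s),
    (vrateBox Kbar h μ ρ x s (k + econf i) i - wrate μ x s (k + econf i) i)

/-- The function `Ξ^□(x̄)`. -/
def XiBox (Kbar : S → Finset (I → ℕ)) (h : S → ℝ) (μ : I → ℝ)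
    (x : S → (I → ℕ) → ℝ) : ℝ :=
  ∑ i : I, ∑ s : S,
    ∑ k ∈ (Kc Kbar s).filter (fun k => 1 ≤ k i ∧ k - econf i ∈ Kbar s),
      ∑ s' : S,
        ∑ k' ∈ (Kc Kbar s').filter (fun k' => 1 ≤ k' i ∧ k' - econf i ∈ Kbar s'),
          (Real.log ((k' i : ℝ) * xvalBox Kbar h x s (k - econf i) * x s' k')
            - Real.log ((k i : ℝ) * x s k * xvalBox Kbar h x s' (k' - econf i)))
          * ((k i : ℝ) * μ i * x s k * xvalBox Kbar h x s' (k' - econf i)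
              / xavailBox Kbar h x i)

lemma ck_pos (k : I → ℕ) : 0 < ck k :=
  Finset.prod_pos fun i _ => by exact_mod_cast Nat.factorial_pos (k i)

lemma le_of_mem_feasX {Kbar : S → Finset (I → ℕ)} {ρ : I → ℝ} {x : S → (I → ℕ) → ℝ}
    (hx : x ∈ feasX Kbar ρ) {s : S} {k : I → ℕ} {i : I} (hki : k i ≠ 0) (hk : k ∈ Kc Kbar s) :
    x s k ≤ ρ i := by
  obtain ⟨⟨hnn, -⟩, hsum⟩ := hx
  have hterm : ∀ s' k', 0 ≤ (k' i : ℝ) * x s' k' := fun s' k' =>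
    mul_nonneg (Nat.cast_nonneg _) (hnn s' k')
  calc x s k ≤ (k i : ℝ) * x s k :=
        le_mul_of_one_le_left (hnn s k) (by exact_mod_cast Nat.one_le_iff_ne_zero.mpr hki)
    _ ≤ ∑ k' ∈ Kc Kbar s, (k' i : ℝ) * x s k' :=
        Finset.single_le_sum (f := fun k' : I → ℕ => (k' i : ℝ) * x s k')
          (fun k' _ => hterm s k') hk
    _ ≤ ∑ s', ∑ k' ∈ Kc Kbar s', (k' i : ℝ) * x s' k' :=
        Finset.single_le_sum (f := fun s' => ∑ k' ∈ Kc Kbar s', (k' i : ℝ) * x s' k')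
          (fun s' _ => Finset.sum_nonneg fun k' _ => hterm s' k') (Finset.mem_univ s)
    _ = ρ i := hsum i

lemma le_one_of_mem_feasX {Kbar : S → Finset (I → ℕ)} {ρ : I → ℝ} (hρpos : ∀ i, 0 < ρ i)
    (hρsum : ∑ i, ρ i = 1) {x : S → (I → ℕ) → ℝ} (hx : x ∈ feasX Kbar ρ) {s : S} {k : I → ℕ}
    (hk : k ∈ Kc Kbar s) : x s k ≤ 1 := by
  obtain ⟨i, hi⟩ : ∃ i, k i ≠ 0 := Function.ne_iff.mp (Finset.ne_of_mem_erase hk)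
  exact (le_of_mem_feasX hx hi hk).trans <| hρsum ▸
    Finset.single_le_sum (fun j _ => (hρpos j).le) (Finset.mem_univ i)

lemma mul_log_div_rpow {x c α g : ℝ} (hc : 0 < c) (hα : 0 < α) :
    x * Real.log (x * c / (Real.exp 1 * α ^ g)) =
      x * (Real.log x + (Real.log c - 1)) + -Real.log α * (g * x) := by
  rcases eq_or_ne x 0 with rfl | hx
  · simp
  · rw [Real.log_div (mul_ne_zero hx hc.ne')
      (mul_ne_zero (Real.exp_ne_zero 1) (Real.rpow_pos_of_pos hα g).ne'),
      Real.log_mul hx hc.ne', Real.log_mul (Real.exp_ne_zero 1) (Real.rpow_pos_of_pos hα g).ne',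
      Real.log_exp, Real.log_rpow hα]
    ring

/-- Splitting of `Lfun` into a part independent of `α` and `-log α` times the objective. -/
lemma Lfun_rpow_eq (Kbar : S → Finset (I → ℕ)) (γ : S → ℝ) (x : S → (I → ℕ) → ℝ)
    {α : ℝ} (hα : 0 < α) :
    Lfun Kbar (fun s => α ^ γ s) x =
      ∑ s, ∑ k ∈ Kc Kbar s, x s k * (Real.log (x s k) + (Real.log (ck k) - 1)) +
        -Real.log α * objW Kbar γ x := by
  simp only [Lfun, objW, mul_log_div_rpow (ck_pos _) hα, Finset.sum_add_distrib, Finset.mul_sum]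

lemma abs_mul_log_add_le {x b : ℝ} (hx0 : 0 ≤ x) (hx1 : x ≤ 1) :
    |x * (Real.log x + b)| ≤ 1 + |b| := by
  have hlog : |x * Real.log x| ≤ 1 := by
    rcases hx0.eq_or_lt with rfl | hpos
    · simp
    · rw [mul_comm]
      exact (Real.abs_log_mul_self_lt x hpos hx1).le
  have hb : |x * b| ≤ |b| := by
    rw [abs_mul, abs_of_nonneg hx0]
    exact mul_le_of_le_one_left (abs_nonneg b) hx1
  rw [mul_add]
  exact (abs_add_le _ _).trans (add_le_add hlog hb)

/-- with `a(α)_s = α^{γ_s}`, the functions `L^{(a(α))}/(−log α)` converge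
uniformly on `X` to the weighted objective, as `α → 0+` (within `(0,1)`). -/
theorem Lfun_normalized_tendstoUniformlyOn_objW
    (Kbar : S → Finset (I → ℕ))
    (hmono : KbarMono Kbar) (hzero : KbarZero Kbar) (hserve : KbarServe Kbar)
    (ρ : I → ℝ) (hρpos : ∀ i, 0 < ρ i) (hρsum : ∑ i, ρ i = 1)
    (γ : S → ℝ) (hγpos : ∀ s, 0 < γ s) (s₁ : S) (hγ1 : γ s₁ = 1) :
    TendstoUniformlyOn
      (fun (α : ℝ) (x : S → (I → ℕ) → ℝ) =>
        Lfun Kbar (fun s => α ^ γ s) x / (-Real.log α))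
      (objW Kbar γ) (nhdsWithin 0 (Set.Ioo (0 : ℝ) 1)) (feasX Kbar ρ) := by
  set C : ℝ := ∑ s, ∑ k ∈ Kc Kbar s, (1 + |Real.log (ck k) - 1|)
  rw [Metric.tendstoUniformlyOn_iff]
  intro ε hε
  have hlog : Tendsto (fun α : ℝ => -Real.log α) (nhdsWithin 0 (Set.Ioo (0 : ℝ) 1)) atTop :=
    tendsto_neg_atBot_atTop.comp <|
      Real.tendsto_log_nhdsGT_zero.mono_left (nhdsWithin_mono 0 Set.Ioo_subset_Ioi_self)
  filter_upwards [hlog.eventually_gt_atTop (C / ε), hlog.eventually_gt_atTop 0,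
    self_mem_nhdsWithin] with α hαC hα0 hα x hx
  have hbound : |∑ s, ∑ k ∈ Kc Kbar s, x s k * (Real.log (x s k) + (Real.log (ck k) - 1))| ≤ C :=
    (Finset.abs_sum_le_sum_abs _ _).trans <| Finset.sum_le_sum fun s _ =>
      (Finset.abs_sum_le_sum_abs _ _).trans <| Finset.sum_le_sum fun k hk =>
        abs_mul_log_add_le (hx.1.1 s k) (le_one_of_mem_feasX hρpos hρsum hx hk)
  rw [dist_comm, Real.dist_eq, Lfun_rpow_eq Kbar γ x hα.1, add_div,
    mul_div_cancel_left₀ _ hα0.ne', add_sub_cancel_right, abs_div, abs_of_pos hα0,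
    div_lt_iff₀ hα0]
  rw [div_lt_iff₀ hε] at hαC
  linarith
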